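/- Let p be prime, Λ = Zp[[X]], F = u · p^μ · ∏_{i=1}^r F_i with u a unit, each F_i distinguished of degree d_i, and λ = Σ d_i. Fix n₀ with p^{n₀−1}(p−1) > d_i for all i, and assume F is coprime to ω_m = (1+X)^{p^m} − 1 for all m. Then for all n ≥ n₀, denoting by e(M) the p-exponent of the order of a finite module M: e(Λ/(F, ω_n)) − e(Λ/(F, ω_{n₀})) = μ·(p^n − p^{n₀}) + λ·(n − n₀). -/

import Mathlib

open PowerSeries

/-- `ω_n = (1+X)^{p^n} - 1` in `Λ = Zp[[X]]`. -/
noncomputable def omegaPS7 (p : ℕ) [Fact p.Prime] (n : ℕ) : PowerSeries ℤ_[p] :=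
  (1 + PowerSeries.X) ^ p ^ n - 1

namespace Stmt7Aux

section general
variable {R : Type*} [CommRing R]

/-- Order of `R/(f,g)`. -/
noncomputable def crd (f g : R) : ℕ := Nat.card (R ⧸ (Ideal.span {f, g}))

theorem crd_comm (f g : R) : crd f g = crd g f := by
  unfold crd; rw [Set.pair_comm]

theorem crd_one (f : R) : crd f 1 = 1 := by
  unfold crd
  have : Ideal.span {f, (1 : R)} = ⊤ := by
    rw [Ideal.eq_top_iff_one]; exact Ideal.subset_span (by simp)
  rw [this]
  have : Subsingleton (R ⧸ (⊤ : Ideal R)) := Ideal.Quotient.subsingleton_iff.2 rfl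
  exact Nat.card_unique

theorem crd_mul (f g h : R) (H : ∀ a, g ∣ f * a → g ∣ a) (hg : IsLeftRegular g) :
    crd f (g * h) = crd f g * crd f h := by
  unfold crd
  have hle : Ideal.span {f, g * h} ≤ Ideal.span {f, g} := by
    rw [Ideal.span_le]
    rintro x (rfl | rfl)
    · exact Ideal.subset_span (by simp)
    · exact Ideal.mul_mem_right _ _ (Ideal.subset_span (by simp))
  let I := Ideal.span {f, g * h}
  let J := Ideal.span {f, g}
  let K := Ideal.span {f, h}
  let φ : (R ⧸ I) →ₗ[R] (R ⧸ J) := Submodule.factor hle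
  have hφ : Function.Surjective φ := Submodule.factor_surjective hle
  let ψ0 : R →ₗ[R] (R ⧸ I) := (Submodule.mkQ I).comp (LinearMap.mulLeft R g)
  have hker : LinearMap.ker ψ0 = K := by
    ext x
    simp only [LinearMap.mem_ker, ψ0, LinearMap.comp_apply, LinearMap.mulLeft_apply,
      Submodule.mkQ_apply, Submodule.Quotient.mk_eq_zero]
    simp only [I, K, Ideal.mem_span_pair]
    constructor
    · rintro ⟨a, b, hab⟩
      obtain ⟨c, rfl⟩ := H a ⟨x - h * b, by linear_combination hab⟩
      refine ⟨c, b, hg ?_⟩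
      simp only
      linear_combination hab
    · rintro ⟨a, b, rfl⟩
      exact ⟨g * a, b, by ring⟩
  have hrange : LinearMap.range ψ0 = LinearMap.ker φ := by
    ext x
    obtain ⟨x, rfl⟩ := Submodule.mkQ_surjective I x
    have h1 : (φ (I.mkQ x) = 0) ↔ x ∈ J := by
      rw [← Submodule.Quotient.mk_eq_zero J]; rfl
    rw [LinearMap.mem_ker, h1]
    simp only [LinearMap.mem_range, ψ0, LinearMap.comp_apply, LinearMap.mulLeft_apply,
      Submodule.mkQ_apply, Submodule.Quotient.eq]
    simp only [I, J, Ideal.mem_span_pair]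
    constructor
    · rintro ⟨y, a, b, hab⟩
      exact ⟨-a, y - b * h, by linear_combination -hab⟩
    · rintro ⟨a, b, hab⟩
      exact ⟨b, -a, 0, by linear_combination -hab⟩
  have e1 : ((R ⧸ I) ⧸ LinearMap.ker φ) ≃ₗ[R] (R ⧸ J) := φ.quotKerEquivOfSurjective hφ
  have e2 : (R ⧸ K) ≃ₗ[R] LinearMap.ker φ :=
    (Submodule.quotEquivOfEq _ _ hker.symm).trans
      (ψ0.quotKerEquivRange.trans (LinearEquiv.ofEq _ _ hrange))
  have := Submodule.card_eq_card_quotient_mul_card (LinearMap.ker φ)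
  rw [Nat.card_congr e1.toEquiv, ← Nat.card_congr e2.toEquiv] at this
  exact this.trans (mul_comm _ _)

theorem crd_pow [IsDomain R] (f g : R) (hg : g ≠ 0) (H : ∀ k a, g ^ k ∣ f * a → g ^ k ∣ a) (k : ℕ) :
    crd f (g ^ k) = crd f g ^ k := by
  induction k with
  | zero => simp [crd_one]
  | succ k ih =>
    rw [pow_succ, crd_mul _ _ _ (H k) (IsLeftCancelMulZero.mul_left_cancel_of_ne_zero (pow_ne_zero _ hg)), ih, pow_succ]

theorem crd_congr (f y x : R) (u : Rˣ) (h : y ∣ f - u * x) : crd f y = crd y x := by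
  unfold crd
  have : Ideal.span {f, y} = Ideal.span {y, x} := by
    obtain ⟨c, hc⟩ := h
    apply le_antisymm <;> rw [Ideal.span_le]
    · rintro z (rfl | rfl)
      · exact Ideal.mem_span_pair.2 ⟨c, u, by linear_combination -hc⟩
      · exact Ideal.subset_span (by simp)
    · rintro z (rfl | rfl)
      · exact Ideal.subset_span (by simp)
      · refine Ideal.mem_span_pair.2 ⟨(u⁻¹ : Rˣ), -(u⁻¹ : Rˣ) * c, ?_⟩
        linear_combination ((u⁻¹ : Rˣ) : R) * hc + z * u.inv_mul
  rw [this]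

theorem dvd_of_prime [IsDomain R] {f g : R} (hf : Prime f) (h : ¬ f ∣ g) (a : R) (ha : g ∣ f * a) :
    g ∣ a := by
  obtain ⟨z, hz⟩ := ha
  obtain ⟨c, rfl⟩ := (hf.dvd_or_dvd ⟨a, hz.symm⟩).resolve_left h
  exact ⟨c, mul_left_cancel₀ hf.ne_zero (by linear_combination hz)⟩

/-- `f` is a unit times `x^N` modulo `y`. -/
def Asc (y x : R) (f : R) (N : ℕ) : Prop := ∃ u : Rˣ, y ∣ f - u * x ^ N

theorem Asc.mul {y x f g : R} {N M : ℕ} (hf : Asc y x f N) (hg : Asc y x g M) :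
    Asc y x (f * g) (N + M) := by
  obtain ⟨u, a, hu⟩ := hf
  obtain ⟨v, b, hv⟩ := hg
  refine ⟨u * v, a * g + b * u * x ^ N, ?_⟩
  push_cast
  linear_combination g * hu + (u : R) * x ^ N * hv

theorem Asc.unit (y x : R) (u : Rˣ) : Asc y x (u : R) 0 := ⟨u, by simp⟩

theorem Asc.pow {y x f : R} {N : ℕ} (hf : Asc y x f N) (k : ℕ) :
    Asc y x (f ^ k) (k * N) := by
  induction k with
  | zero => simpa using Asc.unit y x 1
  | succ k ih => rw [pow_succ, add_mul, one_mul]; exact ih.mul hf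

theorem Asc.prod {y x : R} {ι : Type*} (s : Finset ι) (f : ι → R) (d : ι → ℕ)
    (h : ∀ i, Asc y x (f i) (d i)) : Asc y x (∏ i ∈ s, f i) (∑ i ∈ s, d i) := by
  classical
  induction s using Finset.induction_on with
  | empty => simpa using Asc.unit y x 1
  | insert a s ha ih => rw [Finset.prod_insert ha, Finset.sum_insert ha]; exact (h a).mul ih

end general

variable (p : ℕ) [hp : Fact p.Prime]

local notation "Lam" => PowerSeries ℤ_[p]

theorem p_dvd_of_coeff (f : Lam) (h : ∀ n, (p : ℤ_[p]) ∣ coeff n f) : ∃ w, f = (p : Lam) * w := by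
  choose c hc using h
  refine ⟨PowerSeries.mk c, ?_⟩
  have : (p : Lam) = C (p : ℤ_[p]) := by simp
  ext n
  rw [this, coeff_C_mul, coeff_mk, hc]

theorem p_dvd_iff (x : ℤ_[p]) : (p : ℤ_[p]) ∣ x ↔ PadicInt.toZMod x = 0 := by
  rw [← RingHom.mem_ker, PadicInt.ker_toZMod, PadicInt.maximalIdeal_eq_span_p,
    Ideal.mem_span_singleton]

theorem isUnit_or (x : ℤ_[p]) : IsUnit x ∨ (p : ℤ_[p]) ∣ x := by
  by_cases h : IsUnit x
  · exact Or.inl h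
  · right
    rw [← Ideal.mem_span_singleton, ← PadicInt.maximalIdeal_eq_span_p]
    exact h

theorem p_ne : (p : ℤ_[p]) ≠ 0 := by exact_mod_cast hp.out.ne_zero

theorem p_ne' : (p : Lam) ≠ 0 := by
  intro h
  apply p_ne p
  simpa using congrArg (constantCoeff (R := ℤ_[p])) h

theorem crd_X_p : crd (X : Lam) (p : Lam) = p := by
  unfold crd
  let φ : Lam →+* ZMod p := PadicInt.toZMod.comp (constantCoeff (R := ℤ_[p]))
  have hφ : Function.Surjective φ := ZMod.ringHom_surjective φ
  have hk : RingHom.ker φ = Ideal.span {(X : Lam), (p : Lam)} := by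
    ext f
    rw [RingHom.mem_ker, Ideal.mem_span_pair]
    simp only [φ, RingHom.comp_apply]
    rw [← p_dvd_iff]
    constructor
    · rintro ⟨c, hc⟩
      have : X ∣ f - (p : Lam) * C c := by
        rw [X_dvd_iff]; simp [hc]
      obtain ⟨b, hb⟩ := this
      exact ⟨b, C c, by linear_combination -hb⟩
    · rintro ⟨a, b, rfl⟩
      simp
  rw [← hk, Nat.card_congr (RingHom.quotientKerEquivOfSurjective hφ).toEquiv, Nat.card_zmod]

/-- properties of the Eisenstein factor. -/
structure Eis (ξ : Lam) (φ : ℕ) : Prop where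
  pos : 0 < φ
  ex : ∃ w : Lamˣ, ξ = X ^ φ + (p : Lam) * (w : Lam)

variable {p}
variable {ξ : PowerSeries ℤ_[p]} {φ : ℕ}

theorem Eis.p_asc (h : Eis p ξ φ) : Asc ξ X (p : Lam) φ := by
  obtain ⟨w, hw⟩ := h.ex
  refine ⟨-w⁻¹, (w⁻¹ : Lamˣ), ?_⟩
  rw [hw]
  push_cast
  linear_combination -(p : Lam) * w.mul_inv

theorem isUnit_one_add (a : Lam) : IsUnit (1 + X * a) := by
  rw [isUnit_iff_constantCoeff]; simp

theorem Eis.dist_asc (h : Eis p ξ φ) (f G : Lam) (d : ℕ) (hd : d < φ) (hf : f = X ^ d + (p : Lam) * G) :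
    Asc ξ X f d := by
  obtain ⟨u, c, hc⟩ := h.p_asc
  obtain ⟨e, rfl⟩ : ∃ e, φ = d + (e + 1) := ⟨φ - d - 1, by omega⟩
  obtain ⟨v, hv⟩ := isUnit_one_add (p := p) (X ^ e * (u : Lam) * G)
  refine ⟨v, c * G, ?_⟩
  rw [hf, hv]
  linear_combination G * hc

theorem Eis.const (h : Eis p ξ φ) : constantCoeff ξ ≠ 0 ∧ ¬ IsUnit ξ := by
  obtain ⟨w, rfl⟩ := h.ex
  have h1 := h.pos.ne'
  have hw : IsUnit (constantCoeff (w : Lam)) := isUnit_iff_constantCoeff.1 w.isUnit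
  constructor
  · simp [h1, hp.out.ne_zero, hw.ne_zero]
  · rw [isUnit_iff_constantCoeff]
    simp only [map_add, map_pow, constantCoeff_X, zero_pow h1, map_mul, map_natCast, zero_add]
    intro h2
    exact PadicInt.prime_p.not_isUnit (isUnit_of_mul_isUnit_left h2)

theorem Eis.crd_asc (h : Eis p ξ φ) {f : Lam} {N : ℕ} (hf : Asc ξ X f N) : crd f ξ = p ^ N := by
  obtain ⟨u, hu⟩ := hf
  rw [crd_congr f ξ (X ^ N) u hu, crd_pow _ _ X_ne_zero]
  · have : crd ξ (X : Lam) = crd X (p : Lam) := by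
      obtain ⟨w, hw⟩ := h.ex
      apply crd_congr ξ X (p : Lam) w
      rw [hw, X_dvd_iff]
      simp [h.pos.ne', mul_comm]
    rw [this, crd_X_p]
  · intro k a ha
    refine X_prime.pow_dvd_of_dvd_mul_left k ?_ ha
    rw [X_dvd_iff]; exact h.const.1

theorem Eis.dich (h : Eis p ξ φ) (f : Lam) (hf : ¬ ξ ∣ f) : ∃ N, Asc ξ X f N := by
  classical
  have hnu := h.const.2
  -- Krull
  have hkr : ∃ N, f ∉ Ideal.span {ξ, X ^ N} := by
    by_contra! hall
    apply hf
    have hX : ¬ IsUnit (X : Lam) := X_prime.not_isUnit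
    have hI : Ideal.span {(X : Lam)} ≠ ⊤ := by
      rwa [Ne, Ideal.span_singleton_eq_top]
    have := Ideal.iInf_pow_smul_eq_bot_of_isLocalRing (M := Lam ⧸ Ideal.span {ξ}) _ hI
    rw [← Ideal.mem_span_singleton, ← Ideal.Quotient.eq_zero_iff_mem]
    have hm : (Ideal.Quotient.mk (Ideal.span {ξ}) f) ∈
        (⨅ i : ℕ, Ideal.span {(X : Lam)} ^ i • (⊤ : Submodule Lam (Lam ⧸ Ideal.span {ξ}))) := by
      rw [Submodule.mem_iInf]
      intro i
      obtain ⟨a, b, hab⟩ := Ideal.mem_span_pair.1 (hall i)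
      have : Ideal.Quotient.mk (Ideal.span {ξ}) f
          = (X ^ i : Lam) • Ideal.Quotient.mk (Ideal.span {ξ}) b := by
        have hs : (X ^ i : Lam) • Ideal.Quotient.mk (Ideal.span {ξ}) b
          = Ideal.Quotient.mk (Ideal.span {ξ}) (X ^ i * b) := rfl
        rw [hs, Ideal.Quotient.eq, Ideal.mem_span_singleton]
        exact ⟨a, by linear_combination -hab⟩
      rw [this]
      exact Submodule.smul_mem_smul (Ideal.pow_mem_pow (Ideal.mem_span_singleton_self _) _) trivial
    rw [this] at hm
    simpa using hm
  obtain ⟨M, hM⟩ : ∃ M, Nat.find hkr = M + 1 := by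
    apply Nat.exists_eq_succ_of_ne_zero
    intro h0
    have := Nat.find_spec hkr
    rw [h0] at this
    exact this (Ideal.mem_span_pair.2 ⟨0, f, by simp⟩)
  have h1 := Nat.find_spec hkr
  rw [hM] at h1
  have h2 : f ∈ Ideal.span {ξ, X ^ M} := by
    by_contra h3
    exact Nat.find_min hkr (by omega) h3
  obtain ⟨a, b, hab⟩ := Ideal.mem_span_pair.1 h2
  rcases isUnit_or p (constantCoeff b) with hb | ⟨c, hc⟩
  · obtain ⟨u, rfl⟩ := isUnit_iff_constantCoeff.2 hb
    exact ⟨M, u, a, by linear_combination -hab⟩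
  · exfalso
    apply h1
    have : X ∣ b - (p : Lam) * C c := by
      rw [X_dvd_iff]; simp [hc]
    obtain ⟨b', hb'⟩ := this
    obtain ⟨u, v, huv⟩ := h.p_asc
    obtain ⟨e, rfl⟩ := Nat.exists_eq_succ_of_ne_zero h.pos.ne'
    refine Ideal.mem_span_pair.2 ⟨a + v * C c * X ^ M, b' + (u : Lam) * X ^ e * C c, ?_⟩
    rw [Nat.succ_eq_add_one] at huv
    linear_combination hab - X ^ M * hb' - C c * X ^ M * huv

theorem Eis.prime (h : Eis p ξ φ) : Prime ξ := by
  refine ⟨?_, h.const.2, ?_⟩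
  · intro h0
    apply h.const.1
    rw [h0]; simp
  · intro a b hab
    by_contra! hcon
    obtain ⟨N, hN⟩ := h.dich a hcon.1
    obtain ⟨M, hM⟩ := h.dich b hcon.2
    obtain ⟨u, hu⟩ := hN.mul hM
    have h1 : ξ ∣ (u : Lam) * X ^ (N + M) := by
      have := dvd_sub hab hu
      simpa using this
    have h2 : ξ ∣ X ^ (N + M) := (u.isUnit.dvd_mul_left).1 h1
    obtain ⟨c, hc⟩ := h2
    have h3 : X ^ (N + M) ∣ c := X_prime.pow_dvd_of_dvd_mul_left _
      (by rw [X_dvd_iff]; exact h.const.1) hc.dvd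
    obtain ⟨e, rfl⟩ := h3
    apply h.const.2
    apply IsUnit.of_mul_eq_one e
    apply mul_left_cancel₀ (pow_ne_zero (N + M) (X_ne_zero (R := ℤ_[p])))
    linear_combination -hc

/-- the quotient `ω_{k+1}/ω_k`. -/
noncomputable def xi (p : ℕ) [Fact p.Prime] (k : ℕ) : PowerSeries ℤ_[p] :=
  ∑ i ∈ Finset.range p, ((1 + X) ^ p ^ k) ^ i

theorem omega_succ (k : ℕ) : omegaPS7 p (k + 1) = omegaPS7 p k * xi p k := by
  unfold omegaPS7 xi
  rw [mul_comm, geom_sum_mul, ← pow_mul, ← pow_succ]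

theorem omega_zero : omegaPS7 p 0 = X := by
  simp [omegaPS7]

theorem map_omega (k : ℕ) : PowerSeries.map (PadicInt.toZMod (p := p)) (omegaPS7 p k) = X ^ p ^ k := by
  have : CharP (PowerSeries (ZMod p)) p :=
    charP_of_injective_ringHom (f := (C : ZMod p →+* PowerSeries (ZMod p))) C_injective p
  unfold omegaPS7
  simp [add_pow_char_pow]

theorem xi_eis (k : ℕ) : Eis p (xi p k) (p ^ k * (p - 1)) := by
  have hpos : 0 < p ^ k * (p - 1) :=
    Nat.mul_pos (pow_pos hp.out.pos _) (by have := hp.out.two_le; omega)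
  refine ⟨hpos, ?_⟩
  have hm : PowerSeries.map (PadicInt.toZMod (p := p)) (xi p k) = X ^ (p ^ k * (p - 1)) := by
    apply mul_left_cancel₀ (pow_ne_zero (p ^ k) (X_ne_zero (R := ZMod p)))
    rw [← map_omega, ← map_mul, ← omega_succ, map_omega, map_omega, ← pow_add]
    congr 1
    obtain ⟨q, hq⟩ := Nat.exists_eq_succ_of_ne_zero hp.out.ne_zero
    have : p - 1 + 1 = p := by omega
    calc p ^ (k + 1) = p ^ k * p := pow_succ _ _
      _ = p ^ k * (p - 1 + 1) := by rw [this]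
      _ = _ := by ring
  obtain ⟨w, hw⟩ := p_dvd_of_coeff p (xi p k - X ^ (p ^ k * (p - 1))) (by
    intro n
    rw [p_dvd_iff, ← coeff_map, map_sub, hm]
    simp)
  have hc := congrArg (constantCoeff (R := ℤ_[p])) hw
  have hx : constantCoeff (xi p k) = (p : ℤ_[p]) := by simp [xi]
  rw [map_sub, hx] at hc
  simp only [map_pow, constantCoeff_X, zero_pow hpos.ne', sub_zero, map_mul, map_natCast] at hc
  have hw1 : constantCoeff w = 1 := mul_left_cancel₀ (p_ne p) (by rw [← hc, mul_one])
  obtain ⟨w', rfl⟩ : IsUnit w := by rw [isUnit_iff_constantCoeff, hw1]; exact isUnit_one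
  exact ⟨w', by linear_combination hw⟩

theorem crd_X (f : Lam) (hf : ¬ X ∣ f) : crd f X ≠ 0 := by
  rw [X_dvd_iff] at hf
  have e : constantCoeff f = _ := PadicInt.unitCoeff_spec hf
  set c := PadicInt.unitCoeff hf
  set N := (constantCoeff f).valuation
  rw [crd_congr f X ((p : Lam) ^ N) (Units.map (C (R := ℤ_[p])).toMonoidHom c), crd_pow _ _ (p_ne' p)]
  · rw [crd_X_p]; exact pow_ne_zero _ hp.out.ne_zero
  · intro k a ha
    refine dvd_of_prime X_prime ?_ a ha
    rw [X_dvd_iff]; simp [hp.out.ne_zero]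
  · rw [X_dvd_iff]
    simp [e]

section main

theorem reg {F : PowerSeries ℤ_[p]} (hX : ¬ X ∣ F) (hxi : ∀ k, ¬ xi p k ∣ F) (k : ℕ) : ∀ a, omegaPS7 p k ∣ F * a → omegaPS7 p k ∣ a := by
  induction k with
  | zero =>
    intro a ha
    rw [omega_zero] at *
    exact (X_prime.dvd_or_dvd ha).resolve_left hX
  | succ k ih =>
    intro a ha
    rw [omega_succ] at *
    obtain ⟨b, rfl⟩ := ih a (dvd_of_mul_right_dvd ha)
    have h0 : omegaPS7 p k ≠ 0 := by
      intro h; have := map_omega (p := p) k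
      rw [h, map_zero] at this
      exact pow_ne_zero _ X_ne_zero this.symm
    apply mul_dvd_mul_left
    have : omegaPS7 p k * xi p k ∣ omegaPS7 p k * (F * b) := by
      convert ha using 1; ring
    exact ((xi_eis k).prime.dvd_or_dvd ((mul_dvd_mul_iff_left h0).1 this)).resolve_left (hxi k)

theorem crd_succ {F : PowerSeries ℤ_[p]} (hX : ¬ X ∣ F) (hxi : ∀ k, ¬ xi p k ∣ F) (k : ℕ) : crd F (omegaPS7 p (k + 1)) = crd F (omegaPS7 p k) * crd F (xi p k) := by
  rw [omega_succ]
  refine crd_mul _ _ _ (reg hX hxi k) (IsLeftCancelMulZero.mul_left_cancel_of_ne_zero ?_)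
  intro h; have := map_omega (p := p) k
  rw [h, map_zero] at this
  exact pow_ne_zero _ X_ne_zero this.symm

theorem crd_ne {F : PowerSeries ℤ_[p]} (hX : ¬ X ∣ F) (hxi : ∀ k, ¬ xi p k ∣ F) (k : ℕ) : crd F (omegaPS7 p k) ≠ 0 := by
  induction k with
  | zero => rw [omega_zero]; exact crd_X F hX
  | succ k ih =>
    rw [crd_succ hX hxi]
    obtain ⟨N, hN⟩ := (xi_eis k).dich F (hxi k)
    rw [(xi_eis k).crd_asc hN]
    exact mul_ne_zero ih (pow_ne_zero _ hp.out.ne_zero)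

end main
end Stmt7Aux

open Stmt7Aux

/-- Let `F = u·p^μ·∏ F_i ∈ Λ = Zp[[X]]` with `u` a unit and `F_i`
distinguished of degree `d_i`, `λ = ∑ d_i`.  Fix `n₀` with `p^{n₀-1}(p-1) > d_i` for
all `i`, and assume `F` is coprime to `ω_m` for all `m ≥ 1`.  Then for all `n ≥ n₀`,
the quotients `Λ/(F, ω_n)` are finite and, with `e(M)` the `p`-exponent of `#M`,
`e(Λ/(F, ω_n)) − e(Λ/(F, ω_{n₀})) = μ(p^n − p^{n₀}) + λ(n − n₀)` (stated additively to
avoid truncated subtraction). -/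
theorem stmt7 (p : ℕ) [hp : Fact p.Prime]
    (r μ : ℕ) (u : (PowerSeries ℤ_[p])ˣ) (Fi : Fin r → Polynomial ℤ_[p]) (d : Fin r → ℕ)
    (hmonic : ∀ i, (Fi i).Monic) (hdeg : ∀ i, (Fi i).natDegree = d i)
    (hdist : ∀ i, ∀ j < d i, (Fi i).coeff j ∈ Ideal.span {(p : ℤ_[p])})
    (F : PowerSeries ℤ_[p])
    (hF : F = (u : PowerSeries ℤ_[p]) * (p : PowerSeries ℤ_[p]) ^ μ *
        ∏ i, ((Fi i : Polynomial ℤ_[p]) : PowerSeries ℤ_[p]))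
    (hcop : ∀ m : ℕ, 1 ≤ m →
      ∀ q : PowerSeries ℤ_[p], Irreducible q → q ∣ F → ¬ q ∣ omegaPS7 p m)
    (n₀ : ℕ) (hn₀ : 1 ≤ n₀) (hsmall : ∀ i, d i < p ^ (n₀ - 1) * (p - 1)) :
    ∀ n : ℕ, n₀ ≤ n →
      Finite ((PowerSeries ℤ_[p]) ⧸ (Ideal.span {F, omegaPS7 p n})) ∧
      Finite ((PowerSeries ℤ_[p]) ⧸ (Ideal.span {F, omegaPS7 p n₀})) ∧
      (Nat.card ((PowerSeries ℤ_[p]) ⧸ (Ideal.span {F, omegaPS7 p n}))).factorization p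
          + μ * p ^ n₀ + (∑ i, d i) * n₀ =
        (Nat.card ((PowerSeries ℤ_[p]) ⧸ (Ideal.span {F, omegaPS7 p n₀}))).factorization p
          + μ * p ^ n + (∑ i, d i) * n := by
  have hX : ¬ X ∣ F := fun h => hcop 1 le_rfl X X_prime.irreducible h (by
    rw [omega_succ, omega_zero]; exact dvd_mul_right _ _)
  have hxi : ∀ k, ¬ xi p k ∣ F := fun k h =>
    hcop (k + 1) (by omega) _ (xi_eis k).prime.irreducible h (by
      rw [omega_succ]; exact dvd_mul_left _ _)
  have hfin : ∀ k, Finite ((PowerSeries ℤ_[p]) ⧸ (Ideal.span {F, omegaPS7 p k})) :=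
    fun k => Nat.finite_of_card_ne_zero (crd_ne hX hxi k)
  intro n hn
  refine ⟨hfin n, hfin n₀, ?_⟩
  change (crd F (omegaPS7 p n)).factorization p + _ + _ =
    (crd F (omegaPS7 p n₀)).factorization p + _ + _
  induction n, hn using Nat.le_induction with
  | base => rfl
  | succ n hn ih =>
    have hasc : Asc (xi p n) X F (μ * (p ^ n * (p - 1)) + ∑ i, d i) := by
      rw [hF]
      have h1 := ((Asc.unit (xi p n) X u).mul ((xi_eis n).p_asc.pow μ)).mul
        (Asc.prod Finset.univ (fun i => ((Fi i : Polynomial ℤ_[p]) : PowerSeries ℤ_[p])) d ?_)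
      · rwa [zero_add] at h1
      · intro i
        obtain ⟨G, hG⟩ := p_dvd_of_coeff p
          (((Fi i : Polynomial ℤ_[p]) : PowerSeries ℤ_[p]) - X ^ d i) (by
            intro j
            rw [map_sub, Polynomial.coeff_coe, coeff_X_pow]
            rcases lt_trichotomy j (d i) with h | h | h
            · rw [if_neg h.ne, sub_zero]
              exact Ideal.mem_span_singleton.1 (hdist i j h)
            · have := hmonic i
              rw [Polynomial.Monic, Polynomial.leadingCoeff, hdeg, ← h] at this
              simp [h ▸ this, h]
            · rw [if_neg h.ne', Polynomial.coeff_eq_zero_of_natDegree_lt (by rw [hdeg]; exact h)]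
              simp)
        refine (xi_eis n).dist_asc _ G (d i) ?_ (by linear_combination hG)
        refine (hsmall i).trans_le (Nat.mul_le_mul_right _ ?_)
        exact Nat.pow_le_pow_right hp.out.pos (by omega)
    have hpow : p ^ (n + 1) = p ^ n * (p - 1) + p ^ n := by
      have := hp.out.pos
      rw [pow_succ]
      conv_lhs => rw [show p = (p - 1) + 1 by omega]
      rw [mul_add, mul_one]
      simp [Nat.sub_add_cancel this]
    rw [crd_succ hX hxi, (xi_eis n).crd_asc hasc,
      Nat.factorization_mul (crd_ne hX hxi n) (pow_ne_zero _ hp.out.ne_zero), hpow]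
    rw [Finsupp.add_apply, hp.out.factorization_pow, Finsupp.single_eq_same]
    linear_combination ih
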